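/- arXiv:1711.09756 — 5 statements merged into one kernel-verified Lean document; each statement's English description precedes it below -/
import Mathlib

section
/- Let D be a real number with 1/10 < D < 1. Then for every real reputation score R > 1, the demurrage-updated score satisfies 1 < R · D^(log₁₀ R) < R; moreover, for any D > 0, a score of R = 1 is left unchanged: 1 · D^(log₁₀ 1) = 1. -/
/-- Reputation demurrage with decay rate `1/10 < D < 1` strictly reduces every score
`R > 1` while keeping it above `1`; moreover, for any decay rate `D' > 0` the neutral
score `1` is left unchanged. -/
theorem demurrage_reduces_but_stays_above_one {D : ℝ} (hD₁ : 1 / 10 < D) (hD₂ : D < 1) :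
    (∀ R : ℝ, 1 < R →
      1 < R * D ^ (Real.logb 10 R) ∧ R * D ^ (Real.logb 10 R) < R) ∧
    (∀ D' : ℝ, 0 < D' → (1 : ℝ) * D' ^ (Real.logb 10 (1 : ℝ)) = 1) := by
  refine ⟨fun R hR => ?_, fun D' _ => by simp⟩
  have hR₀ : 0 < R := by linarith
  have hlog : 0 < Real.logb 10 R := Real.logb_pos (by norm_num) hR
  constructor
  · have hpow : (1 / 10 : ℝ) ^ Real.logb 10 R = R⁻¹ := by
      rw [one_div, Real.inv_rpow (by norm_num),
        Real.rpow_logb (by norm_num) (by norm_num) hR₀]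
    have hlt : R⁻¹ < D ^ Real.logb 10 R :=
      hpow ▸ Real.rpow_lt_rpow (by norm_num) hD₁ hlog
    calc 1 = R * R⁻¹ := (mul_inv_cancel₀ hR₀.ne').symm
      _ < R * D ^ Real.logb 10 R := mul_lt_mul_of_pos_left hlt hR₀
  · exact mul_lt_of_lt_one_right hR₀ (Real.rpow_lt_one (by linarith) hD₂ hlog)
end

section
/- Let D > 0 and R₀ > 0 be real numbers, and define the sequence R : ℕ → ℝ by R 0 = R₀ and R (n+1) = R n · D^(log₁₀ (R n)). Then every R n is positive and R n = R₀^((1 + log₁₀ D)^n) for all n : ℕ. -/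
theorem Real.mul_rpow_logb_eq_rpow_one_add_logb {b D x : ℝ} (hD : 0 < D) (hx : 0 < x) :
    x * D ^ Real.logb b x = x ^ (1 + Real.logb b D) := by
  rw [Real.rpow_add hx, Real.rpow_one, Real.rpow_def_of_pos hD, Real.rpow_def_of_pos hx,
    Real.logb, Real.logb, mul_div_left_comm]

/-- If `R` is the reputation sequence of an idle participant, `R 0 = R₀ > 0` and
`R (n+1) = R n · D^(log₁₀ (R n))` with decay rate `D > 0`, then every `R n` is positive
and `R n = R₀ ^ ((1 + log₁₀ D)^n)`. -/
theorem demurrage_closed_form {D R₀ : ℝ} (hD : 0 < D) (hR₀ : 0 < R₀)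
    (R : ℕ → ℝ) (h0 : R 0 = R₀)
    (hrec : ∀ n : ℕ, R (n + 1) = R n * D ^ (Real.logb 10 (R n))) :
    ∀ n : ℕ, 0 < R n ∧ R n = R₀ ^ ((1 + Real.logb 10 D) ^ n) := by
  suffices h : ∀ n : ℕ, R n = R₀ ^ ((1 + Real.logb 10 D) ^ n) from
    fun n => ⟨h n ▸ Real.rpow_pos_of_pos hR₀ _, h n⟩
  intro n
  induction n with
  | zero => simp [h0]
  | succ n ih =>
    rw [hrec, ih, Real.mul_rpow_logb_eq_rpow_one_add_logb hD (Real.rpow_pos_of_pos hR₀ _),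
      ← Real.rpow_mul hR₀.le, ← pow_succ]
end

section
/- Let D be a real number with 1/10 < D < 1 and let R₀ > 0. Define R : ℕ → ℝ by R 0 = R₀ and R (n+1) = R n · D^(log₁₀ (R n)). Then R n tends to 1 as n → ∞. -/
/-- One step of demurrage multiplies the base-`b` logarithm of a score by `1 + logb b D`. -/
theorem logb_mul_rpow_logb {b D x : ℝ} (hD : 0 < D) (hx : 0 < x) :
    Real.logb b (x * D ^ Real.logb b x) = (1 + Real.logb b D) * Real.logb b x := by
  rw [Real.logb_mul hx.ne' (Real.rpow_pos_of_pos hD _).ne',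
    Real.logb_rpow_eq_mul_logb_of_pos hD]
  ring

/-- With decay rate `1/10 < D < 1`, the reputation score of an idle participant converges
to the neutral score `1` under repeated demurrage. -/
theorem demurrage_tendsto_one {D R₀ : ℝ} (hD₁ : 1 / 10 < D) (hD₂ : D < 1) (hR₀ : 0 < R₀)
    (R : ℕ → ℝ) (h0 : R 0 = R₀)
    (hrec : ∀ n : ℕ, R (n + 1) = R n * D ^ (Real.logb 10 (R n))) :
    Filter.Tendsto R Filter.atTop (nhds 1) := by
  have hD : 0 < D := by linarith
  have hpos : ∀ n, 0 < R n := by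
    intro n
    induction n with
    | zero => rwa [h0]
    | succ n ih => rw [hrec]; exact mul_pos ih (Real.rpow_pos_of_pos hD _)
  have hlog : ∀ n, Real.logb 10 (R n) = (1 + Real.logb 10 D) ^ n * Real.logb 10 R₀ := by
    intro n
    induction n with
    | zero => simp [h0]
    | succ n ih => rw [hrec, logb_mul_rpow_logb hD (hpos n), ih]; ring
  have hneg : Real.logb 10 D < 0 := Real.logb_neg (by norm_num) hD hD₂
  have hgt : -1 < Real.logb 10 D := by
    rw [Real.lt_logb_iff_rpow_lt (by norm_num) hD, Real.rpow_neg_one]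
    simpa using hD₁
  have hR : R = fun n ↦ (10 : ℝ) ^ ((1 + Real.logb 10 D) ^ n * Real.logb 10 R₀) := by
    funext n
    rw [← hlog, Real.rpow_logb (by norm_num) (by norm_num) (hpos n)]
  have hlim : Filter.Tendsto (fun n : ℕ ↦ (1 + Real.logb 10 D) ^ n * Real.logb 10 R₀)
      Filter.atTop (nhds 0) := by
    simpa using (tendsto_pow_atTop_nhds_zero_of_lt_one
      (by linarith) (by linarith)).mul_const (Real.logb 10 R₀)
  rw [hR]
  simpa [Function.comp_def] using
    (Real.continuousAt_const_rpow (a := 10) (b := 0) (by norm_num)).tendsto.comp hlim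
end

section
/- Let D be a real number with D > 1/10. Then the demurrage map R ↦ R · D^(log₁₀ R) is strictly monotone increasing on the set of positive reals: if 0 < R₁ < R₂ then R₁ · D^(log₁₀ R₁) < R₂ · D^(log₁₀ R₂). In particular, applying demurrage to all participants' scores preserves their relative ordering. -/
/-- In terms of the order of magnitude `log₁₀ R`, demurrage is exponentiation with base `10 D`. -/
theorem demurrage_eq_rpow {D R : ℝ} (hD : 0 ≤ D) (hR : 0 < R) :
    R * D ^ (Real.logb 10 R) = (10 * D) ^ (Real.logb 10 R) := by
  rw [Real.mul_rpow (by norm_num) hD, Real.rpow_logb (by norm_num) (by norm_num) hR]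

/-- For a decay rate `D > 1/10`, the demurrage map `R ↦ R · D^(log₁₀ R)` is strictly
monotone increasing on the positive reals, so demurrage preserves the relative ordering
of participants' scores. -/
theorem demurrage_strictMono {D : ℝ} (hD : 1 / 10 < D) :
    ∀ R₁ R₂ : ℝ, 0 < R₁ → R₁ < R₂ →
      R₁ * D ^ (Real.logb 10 R₁) < R₂ * D ^ (Real.logb 10 R₂) := by
  intro R₁ R₂ h₁ h₂
  have hD₀ : 0 ≤ D := by linarith
  rw [demurrage_eq_rpow hD₀ h₁, demurrage_eq_rpow hD₀ (h₁.trans h₂)]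
  exact Real.rpow_lt_rpow_of_exponent_lt (by linarith) (Real.logb_lt_logb (by norm_num) h₁ h₂)
end

section
/- Define the per-block reward reward : ℕ → ℝ by reward k = 500 / 2^(k / 1750000), where k / 1750000 is natural-number (floor) division. Then for every n : ℕ, the cumulative issuance over the first n blocks satisfies ∑_{k=0}^{n-1} reward k ≤ 2500000000. -/
/-- The per-block reward: block `k` pays `500 / 2^⌊k / 1750000⌋` wits. -/
noncomputable def reward (k : ℕ) : ℝ := 500 / 2 ^ (k / 1750000)

/-- Summing `f (k / m)` over the first `q` blocks of length `m` counts each value `m` times. -/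
theorem sum_range_mul_div {M : Type*} [AddCommMonoid M] (f : ℕ → M) {m : ℕ} (hm : 0 < m) (q : ℕ) :
    ∑ k ∈ Finset.range (m * q), f (k / m) = m • ∑ j ∈ Finset.range q, f j := by
  induction q with
  | zero => simp
  | succ q ih =>
    have h : ∀ x ∈ Finset.range m, f ((m * q + x) / m) = f q := fun x hx => by
      rw [Nat.mul_add_div hm, Nat.div_eq_of_lt (Finset.mem_range.mp hx), add_zero]
    rw [mul_add_one, Finset.sum_range_add, ih, Finset.sum_congr rfl h, Finset.sum_range_succ,
      smul_add, Finset.sum_const, Finset.card_range]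

/-- The total of a reward `c` halved every `m` blocks is at most `2 * m * c`. -/
theorem sum_range_halving_le {c : ℝ} (hc : 0 ≤ c) {m : ℕ} (hm : 0 < m) (n : ℕ) :
    ∑ k ∈ Finset.range n, c / 2 ^ (k / m) ≤ 2 * m * c :=
  calc
    ∑ k ∈ Finset.range n, c / 2 ^ (k / m) ≤ ∑ k ∈ Finset.range (m * n), c / 2 ^ (k / m) :=
      Finset.sum_le_sum_of_subset_of_nonneg
        (Finset.range_subset_range.mpr (Nat.le_mul_of_pos_left n hm))
        fun _ _ _ => by positivity
    _ = m * (c * ∑ j ∈ Finset.range n, (1 / 2 : ℝ) ^ j) := by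
      rw [sum_range_mul_div (fun j => c / 2 ^ j) hm, nsmul_eq_mul, Finset.mul_sum]
      simp only [div_eq_mul_inv, one_mul, inv_pow, ← Finset.mul_sum]
    _ ≤ m * (c * 2) := by
      gcongr
      exact sum_geometric_two_le n
    _ = 2 * m * c := by ring

/-- The cumulative issuance over any first `n` blocks never exceeds `2,500,000,000`. -/
theorem cumulative_issuance_le (n : ℕ) :
    ∑ k ∈ Finset.range n, reward k ≤ 2500000000 := by
  have h := sum_range_halving_le (c := 500) (by norm_num) (m := 1750000) (by norm_num) n
  unfold reward
  exact h.trans (by norm_num)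
end
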